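/- Let K be a field of characteristic zero and n ≥ 5. Let g and g̃ be ℤ_{>0}-filtered deformations of V_n, with distinguished bases e_1, …, e_n and ẽ_1, …, ẽ_n respectively, and let φ : g → g̃ be an isomorphism of Lie algebras. Then there exists α ∈ K with α ≠ 0 such that for every 1 ≤ i ≤ n one has φ(e_i) − α^i·ẽ_i ∈ span(ẽ_{i+1}, …, ẽ_n). -/

import Mathlib

namespace Paper

open Module Submodule

variable (K : Type*) [Field K] {g : Type*} [LieRing g] [LieAlgebra K g]

/-- `E : ℕ → g` enumerates a basis `e_1, …, e_n` of a `ℤ_{>0}`-filtered deformation of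
the Lie algebra `V_n` (with `E m = 0` for `m = 0` or `m > n`): there are structure
constants `c` with `⁅e_i, e_j⁆ = (j - i) • e_{i+j} + Σ_{l=1}^{n-i-j} c_{ij}^l • e_{i+j+l}`
for `i + j ≤ n` and `⁅e_i, e_j⁆ = 0` for `i + j > n` (`1 ≤ i < j ≤ n`). -/
def IsFilteredDeformationBasis (n : ℕ) (E : ℕ → g) : Prop :=
  (∃ b : Basis (Fin n) K g, ∀ i : Fin n, E ((i : ℕ) + 1) = b i) ∧
  (∀ m : ℕ, m = 0 ∨ n < m → E m = 0) ∧
  (∃ c : ℕ → ℕ → ℕ → K, ∀ i j : ℕ, 1 ≤ i → i < j → j ≤ n →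
    ⁅E i, E j⁆ = ((j : K) - (i : K)) • E (i + j) +
      ∑ l ∈ Finset.Icc 1 (n - (i + j)), c i j l • E (i + j + l))

section helpers

variable {K : Type*} [Field K] {g : Type*} [LieRing g] [LieAlgebra K g]
  {h : Type*} [LieRing h] [LieAlgebra K h]

/-- The filtration. -/
def Fil (K : Type*) [Field K] {g : Type*} [LieRing g] [LieAlgebra K g]
    (n : ℕ) (E : ℕ → g) (k : ℕ) : Submodule K g :=
  Submodule.span K (E '' Set.Icc k n)

lemma Fil_anti {n : ℕ} {E : ℕ → g} {k l : ℕ} (hkl : k ≤ l) : Fil K n E l ≤ Fil K n E k :=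
  Submodule.span_mono (Set.image_mono (Set.Icc_subset_Icc_left hkl))

lemma Fil_bot {n : ℕ} {E : ℕ → g} {k : ℕ} (hk : n < k) : Fil K n E k = ⊥ := by
  simp [Fil, Set.Icc_eq_empty_of_lt hk]

lemma mem_Fil {n : ℕ} {E : ℕ → g} (hE : IsFilteredDeformationBasis K n E) (k l : ℕ)
    (hkl : k ≤ l) : E l ∈ Fil K n E k := by
  by_cases hl : l ≤ n
  · exact Submodule.subset_span ⟨l, ⟨hkl, hl⟩, rfl⟩
  · rw [hE.2.1 l (Or.inr (by omega))]; exact zero_mem _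

lemma Fil_lead {n : ℕ} {E : ℕ → g} {k : ℕ} {x : g} (hx : x ∈ Fil K n E k) :
    ∃ a : K, x - a • E k ∈ Fil K n E (k + 1) := by
  by_cases hk : k ≤ n
  · have : Set.Icc k n = insert k (Set.Icc (k + 1) n) := by
      ext m; simp only [Set.mem_Icc, Set.mem_insert_iff]; omega
    rw [Fil, this, Set.image_insert_eq, Submodule.mem_span_insert] at hx
    obtain ⟨a, z, hz, rfl⟩ := hx
    exact ⟨a, by simpa [Fil] using hz⟩
  · rw [Fil_bot (by omega)] at hx
    exact ⟨0, by simp [(Submodule.mem_bot K).1 hx]⟩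

lemma mem_Fil_one {n : ℕ} {E : ℕ → g} (hE : IsFilteredDeformationBasis K n E) (x : g) :
    x ∈ Fil K n E 1 := by
  obtain ⟨⟨b, hb⟩, -⟩ := hE
  have := b.span_eq
  have h2 : (⊤ : Submodule K g) ≤ Fil K n E 1 := by
    rw [← this, Submodule.span_le]
    rintro _ ⟨i, rfl⟩
    rw [← hb]
    exact Submodule.subset_span ⟨_, ⟨by omega, by omega⟩, rfl⟩
  exact h2 trivial

lemma Fil_indep {n : ℕ} {E : ℕ → g} (hE : IsFilteredDeformationBasis K n E) {k : ℕ}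
    (h1 : 1 ≤ k) (h2 : k ≤ n) {a : K} (ha : a • E k ∈ Fil K n E (k + 1)) : a = 0 := by
  obtain ⟨⟨b, hb⟩, -⟩ := hE
  have key : Fil K n E (k + 1) ≤ LinearMap.ker (b.coord ⟨k - 1, by omega⟩) := by
    rw [Fil, Submodule.span_le]
    rintro _ ⟨m, ⟨hm1, hm2⟩, rfl⟩
    have := hb ⟨m - 1, by omega⟩
    simp only [Nat.sub_add_cancel (show 1 ≤ m by omega)] at this
    simp only [SetLike.mem_coe, LinearMap.mem_ker, this, Basis.coord_apply, Basis.repr_self]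
    rw [Finsupp.single_apply, if_neg]
    simp only [Fin.mk.injEq]; omega
  have h3 := key ha
  have := hb ⟨k - 1, by omega⟩
  simp only [Nat.sub_add_cancel h1] at this
  simpa [this] using h3

lemma br_basis {n : ℕ} {E : ℕ → g} (hE : IsFilteredDeformationBasis K n E) {i j : ℕ}
    (hi : 1 ≤ i) (hj : 1 ≤ j) :
    ⁅E i, E j⁆ - ((j : K) - i) • E (i + j) ∈ Fil K n E (i + j + 1) := by
  have aux : ∀ i j : ℕ, 1 ≤ i → i < j →
      ⁅E i, E j⁆ - ((j : K) - i) • E (i + j) ∈ Fil K n E (i + j + 1) := by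
    intro i j hi hij
    by_cases hj : j ≤ n
    · obtain ⟨c, hc⟩ := hE.2.2
      rw [hc i j hi hij hj, add_sub_cancel_left]
      refine Submodule.sum_mem _ fun l hl => Submodule.smul_mem _ _ (mem_Fil hE _ _ ?_)
      have := (Finset.mem_Icc.1 hl).1
      omega
    · rw [hE.2.1 j (Or.inr (by omega)), hE.2.1 (i + j) (Or.inr (by omega))]
      simp
  rcases lt_trichotomy i j with hij | rfl | hij
  · exact aux i j hi hij
  · simp
  · have := Submodule.neg_mem _ (aux j i hj hij)
    rw [add_comm j i] at this
    convert this using 1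
    rw [← lie_skew (E i) (E j)]
    module

lemma br_Fil {n : ℕ} {E : ℕ → g} (hE : IsFilteredDeformationBasis K n E) {i j : ℕ}
    (hi : 1 ≤ i) (hj : 1 ≤ j) {x y : g} (hx : x ∈ Fil K n E i) (hy : y ∈ Fil K n E j) :
    ⁅x, y⁆ ∈ Fil K n E (i + j) := by
  refine Submodule.span_induction ?_ ?_ ?_ ?_ hx
  · rintro _ ⟨k, ⟨hk, -⟩, rfl⟩
    refine Submodule.span_induction ?_ ?_ ?_ ?_ hy
    · rintro _ ⟨l, ⟨hl, -⟩, rfl⟩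
      have h1 := Fil_anti (K := K) (n := n) (E := E) (show i + j ≤ k + l + 1 by omega)
        (br_basis hE (show 1 ≤ k by omega) (show 1 ≤ l by omega))
      have h2 := Submodule.smul_mem _ ((l : K) - k) (mem_Fil hE (i + j) (k + l) (by omega))
      simpa using add_mem h1 h2
    · simp
    · intro u v _ _ hu hv
      rw [lie_add]; exact add_mem hu hv
    · intro a u _ hu
      rw [lie_smul]; exact Submodule.smul_mem _ _ hu
  · simp
  · intro u v _ _ hu hv
    rw [add_lie]; exact add_mem hu hv
  · intro a u _ hu
    rw [smul_lie]; exact Submodule.smul_mem _ _ hu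

lemma br_lead {n : ℕ} {E : ℕ → g} (hE : IsFilteredDeformationBasis K n E) {i j : ℕ}
    (hi : 1 ≤ i) (hj : 1 ≤ j) {x y : g} {a b : K} (hx : x - a • E i ∈ Fil K n E (i + 1))
    (hy : y - b • E j ∈ Fil K n E (j + 1)) :
    ⁅x, y⁆ - (a * b * ((j : K) - i)) • E (i + j) ∈ Fil K n E (i + j + 1) := by
  have hyj : y ∈ Fil K n E j := by
    simpa using add_mem (Fil_anti (Nat.le_succ j) hy)
      (Submodule.smul_mem _ b (mem_Fil hE j j le_rfl))
  have h1 := br_Fil hE (by omega) hj hx hyj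
  have h2 := br_Fil hE hi (by omega) (mem_Fil hE i i le_rfl) hy
  have h3 := br_basis hE hi hj
  rw [show i + 1 + j = i + j + 1 by omega] at h1
  have := add_mem (add_mem h1 (Submodule.smul_mem _ a h2)) (Submodule.smul_mem _ (a * b) h3)
  convert this using 1
  simp only [sub_lie, lie_sub, smul_lie, lie_smul]
  module

lemma br_one {n : ℕ} {E : ℕ → g} (hE : IsFilteredDeformationBasis K n E) (x y : g) :
    ⁅x, y⁆ ∈ Fil K n E 3 := by
  obtain ⟨a, ha⟩ := Fil_lead (mem_Fil_one hE x)
  obtain ⟨b, hb⟩ := Fil_lead (mem_Fil_one hE y)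
  simpa using br_lead hE le_rfl le_rfl ha hb

lemma Fil_surj [CharZero K] {n : ℕ} {E : ℕ → g} (hE : IsFilteredDeformationBasis K n E)
    (m : ℕ) : ∀ k : ℕ, 2 ≤ k → n ≤ k + m → ∀ x ∈ Fil K n E (k + 1),
    ∃ y ∈ Fil K n E k, x = ⁅E 1, y⁆ := by
  induction m with
  | zero =>
    intro k _ hk x hx
    rw [Fil_bot (by omega)] at hx
    exact ⟨0, zero_mem _, by simpa using hx⟩
  | succ m ih =>
    intro k h2 hk x hx
    obtain ⟨a, ha⟩ := Fil_lead hx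
    have hb := br_basis hE (le_refl 1) (show 1 ≤ k by omega)
    have hk0 : ((k : K) - (1 : ℕ)) ≠ 0 := by
      rw [sub_ne_zero]; exact_mod_cast (by omega : k ≠ 1)
    rw [add_comm 1 k] at hb
    obtain ⟨y, hy, hy2⟩ := ih (k + 1) (by omega) (by omega) _
      (sub_mem ha (Submodule.smul_mem _ (a / ((k : K) - (1 : ℕ))) hb))
    refine ⟨y + (a / ((k : K) - (1 : ℕ))) • E k,
      add_mem (Fil_anti (Nat.le_succ k) hy) (Submodule.smul_mem _ _ (mem_Fil hE k k le_rfl)), ?_⟩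
    rw [lie_add, ← hy2, lie_smul, smul_sub, smul_smul, div_mul_cancel₀ _ hk0]
    module

lemma map_Fil3 [CharZero K] {n : ℕ} {E : ℕ → g} (hE : IsFilteredDeformationBasis K n E)
    {F : ℕ → h} (hF : IsFilteredDeformationBasis K n F)
    (φ : g ≃ₗ[K] h) (hφ : ∀ a b : g, φ ⁅a, b⁆ = ⁅φ a, φ b⁆) (k : ℕ) (hk : 3 ≤ k) :
    ∀ x ∈ Fil K n E k, φ x ∈ Fil K n F k := by
  induction k, hk using Nat.le_induction with
  | base =>
    intro x hx
    obtain ⟨y, -, rfl⟩ := Fil_surj hE n 2 le_rfl (by omega) x hx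
    rw [hφ]; exact br_one hF _ _
  | succ k hk ih =>
    intro x hx
    obtain ⟨y, hy, rfl⟩ := Fil_surj hE n k (by omega) (by omega) x hx
    rw [hφ, add_comm k 1]
    exact br_Fil hF le_rfl (by omega) (mem_Fil_one hF _) (ih y hy)

lemma symm_br (φ : g ≃ₗ[K] h) (hφ : ∀ a b : g, φ ⁅a, b⁆ = ⁅φ a, φ b⁆) (a b : h) :
    φ.symm ⁅a, b⁆ = ⁅φ.symm a, φ.symm b⁆ := by
  apply φ.injective; simp [hφ]

lemma map_Fil [CharZero K] {n : ℕ} (hn : 5 ≤ n) {E : ℕ → g}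
    (hE : IsFilteredDeformationBasis K n E)
    {F : ℕ → h} (hF : IsFilteredDeformationBasis K n F)
    (φ : g ≃ₗ[K] h) (hφ : ∀ a b : g, φ ⁅a, b⁆ = ⁅φ a, φ b⁆) (k : ℕ) (hk : 2 ≤ k) :
    ∀ x ∈ Fil K n E k, φ x ∈ Fil K n F k := by
  rcases Nat.lt_or_ge 2 k with h3 | h3
  · exact map_Fil3 hE hF φ hφ k h3
  obtain rfl : k = 2 := by omega
  obtain ⟨m, rfl⟩ : ∃ m, n = m + 1 := ⟨n - 1, by omega⟩
  intro x hx
  obtain ⟨c, hc⟩ := Fil_lead (mem_Fil_one hF (φ x))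
  obtain ⟨p, hp⟩ := Fil_lead (map_Fil3 hE hF φ hφ m (by omega) _ (mem_Fil hE m m le_rfl))
  have hp0 : p ≠ 0 := by
    rintro rfl
    rw [zero_smul, sub_zero] at hp
    have := map_Fil3 hF hE φ.symm (symm_br φ hφ) (m + 1) (by omega) _ hp
    rw [LinearEquiv.symm_apply_apply] at this
    exact one_ne_zero (Fil_indep hE (k := m) (by omega) (by omega) (a := (1 : K)) (by simpa using this))
  have h0 := br_Fil hE (by omega) (by omega) hx (mem_Fil hE m m le_rfl)
  rw [Fil_bot (by omega), Submodule.mem_bot] at h0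
  have h1 := br_lead hF le_rfl (by omega) hc hp
  rw [← hφ, h0, map_zero, zero_sub, ← neg_smul, add_comm 1 m] at h1
  have h2 := Fil_indep hF (by omega) le_rfl h1
  have hm : ((m : K) - (1 : ℕ)) ≠ 0 := by
    rw [sub_ne_zero]; exact_mod_cast (by omega : m ≠ 1)
  have hc0 : c = 0 := by simpa [hp0, sub_eq_zero, show m ≠ 1 by omega] using h2
  simpa [hc0] using hc

lemma lead_ne [CharZero K] {n : ℕ} (hn : 5 ≤ n) {E : ℕ → g}
    (hE : IsFilteredDeformationBasis K n E)
    {F : ℕ → h} (hF : IsFilteredDeformationBasis K n F)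
    (φ : g ≃ₗ[K] h) (hφ : ∀ a b : g, φ ⁅a, b⁆ = ⁅φ a, φ b⁆) (k : ℕ) (hk : 1 ≤ k) (hkn : k ≤ n)
    {a : K} (ha : φ (E k) - a • F k ∈ Fil K n F (k + 1)) : a ≠ 0 := by
  rintro rfl
  rw [zero_smul, sub_zero] at ha
  have := map_Fil hn hF hE φ.symm (symm_br φ hφ) (k + 1) (by omega) _ ha
  rw [LinearEquiv.symm_apply_apply] at this
  exact one_ne_zero (Fil_indep hE hk hkn (a := (1 : K)) (by simpa using this))

lemma lead_br [CharZero K] {n : ℕ} (hn : 5 ≤ n) {E : ℕ → g}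
    (hE : IsFilteredDeformationBasis K n E)
    {F : ℕ → h} (hF : IsFilteredDeformationBasis K n F)
    (φ : g ≃ₗ[K] h) (hφ : ∀ a b : g, φ ⁅a, b⁆ = ⁅φ a, φ b⁆) {i j : ℕ} (hi : 1 ≤ i) (hij : i < j)
    {a b : K} (ha : φ (E i) - a • F i ∈ Fil K n F (i + 1))
    (hb : φ (E j) - b • F j ∈ Fil K n F (j + 1)) :
    φ (E (i + j)) - (a * b) • F (i + j) ∈ Fil K n F (i + j + 1) := by
  have h1 := br_lead hF hi (by omega) ha hb
  have h2 := map_Fil hn hE hF φ hφ _ (by omega) _ (br_basis hE hi (show 1 ≤ j by omega))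
  have h0 : ((j : K) - i) ≠ 0 := by
    rw [sub_ne_zero]; exact_mod_cast hij.ne'
  rw [map_sub, hφ, map_smul] at h2
  refine (Submodule.smul_mem_iff _ h0).1 ?_
  convert sub_mem h1 h2 using 1
  module

end helpers

/-- an isomorphism between two `ℤ_{>0}`-filtered deformations of `V_n`
(`n ≥ 5`) is triangular: there is `α ≠ 0` with
`φ(e_i) ≡ α^i • ẽ_i mod span(ẽ_{i+1}, …, ẽ_n)` for all `1 ≤ i ≤ n`. -/
theorem statement7 {K : Type*} [Field K] [CharZero K] (n : ℕ) (hn : 5 ≤ n)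
    {g : Type*} [LieRing g] [LieAlgebra K g] (E : ℕ → g)
    (hg : IsFilteredDeformationBasis K n E)
    {h : Type*} [LieRing h] [LieAlgebra K h] (F : ℕ → h)
    (hh : IsFilteredDeformationBasis K n F)
    (φ : g ≃ₗ[K] h) (hφ : ∀ a b : g, φ ⁅a, b⁆ = ⁅φ a, φ b⁆) :
    ∃ α : K, α ≠ 0 ∧ ∀ i : ℕ, 1 ≤ i → i ≤ n →
      φ (E i) - α ^ i • F i ∈ Submodule.span K (F '' Set.Icc (i + 1) n) := by
  change ∃ α : K, α ≠ 0 ∧ ∀ i : ℕ, 1 ≤ i → i ≤ n → φ (E i) - α ^ i • F i ∈ Fil K n F (i + 1)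
  obtain ⟨a, ha⟩ := Fil_lead (mem_Fil_one hh (φ (E 1)))
  obtain ⟨d, hd⟩ := Fil_lead (map_Fil hn hg hh φ hφ 2 le_rfl _ (mem_Fil hg 2 2 le_rfl))
  have ha0 := lead_ne hn hg hh φ hφ 1 le_rfl (by omega) ha
  have hd0 := lead_ne hn hg hh φ hφ 2 (by omega) (by omega) hd
  have h3 := lead_br hn hg hh φ hφ le_rfl (by omega) ha hd
  have h4 := lead_br hn hg hh φ hφ le_rfl (by omega) ha h3
  have h5 := lead_br hn hg hh φ hφ le_rfl (by omega) ha h4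
  have h5' := lead_br hn hg hh φ hφ (by omega) (by omega) hd h3
  norm_num at h5 h5'
  have h6 := sub_mem h5' h5
  have h7 : a * (a * (a * d)) - d * (a * d) = 0 := by
    refine Fil_indep hh (k := 5) (by omega) hn ?_
    convert h6 using 1
    module
  have hda : d = a ^ 2 := by
    have : (a * d) * (a ^ 2 - d) = 0 := by linear_combination h7
    rcases mul_eq_zero.1 this with h | h
    · exact absurd h (mul_ne_zero ha0 hd0)
    · linear_combination -h
  subst hda
  refine ⟨a, ha0, fun i hi _ => ?_⟩
  rcases Nat.lt_or_ge 1 i with h2 | h2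
  · clear hi
    induction i, h2 using Nat.le_induction with
    | base => exact hd
    | succ k hk ih =>
      have := lead_br hn hg hh φ hφ le_rfl hk ha (ih (by omega))
      rwa [← pow_succ', add_comm 1 k] at this
  · obtain rfl : i = 1 := by omega
    simpa using ha

end Paper
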